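/- Let τ > 1 be a real number and let X ≥ 433 be a real number. Then Σ_{n ≥ X} d(n)²/n^τ ≤ (τ/(4X^{τ−1}))·((log X)³/(τ−1) + 3(log X)²/(τ−1)² + 6(log X)/(τ−1)³ + 6/(τ−1)⁴), where the sum runs over all integers n ≥ X. -/

import Mathlib

open Real

/-- `d n` is the number of positive divisors of `n`. -/
def numDiv (n : ℕ) : ℕ := n.divisors.card

/-- The closed form of `(τ / 4) ∫_t^∞ (log u)³ u^(-τ) du`. -/
noncomputable def logCubeTail (τ t : ℝ) : ℝ :=
  τ / 4 * t ^ (1 - τ) * ((log t) ^ 3 / (τ - 1) + 3 * (log t) ^ 2 / (τ - 1) ^ 2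
    + 6 * log t / (τ - 1) ^ 3 + 6 / (τ - 1) ^ 4)

theorem hasDerivAt_logCubeTail {τ t : ℝ} (hτ : 1 < τ) (ht : 0 < t) :
    HasDerivAt (logCubeTail τ) (-(τ / 4 * (log t) ^ 3 * t ^ (-τ))) t := by
  have hs : τ - 1 ≠ 0 := (sub_pos.2 hτ).ne'
  have hl := hasDerivAt_log ht.ne'
  have hp : HasDerivAt (fun t : ℝ => t ^ (1 - τ)) ((1 - τ) * t ^ (1 - τ - 1)) t :=
    hasDerivAt_rpow_const (Or.inl ht.ne')
  have h := (hp.const_mul (τ / 4)).mul (((((hl.pow 3).div_const (τ - 1)).add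
    (((hl.pow 2).const_mul 3).div_const ((τ - 1) ^ 2))).add
    ((hl.const_mul 6).div_const ((τ - 1) ^ 3))).add_const (6 / (τ - 1) ^ 4))
  refine h.congr_deriv ?_
  have e1 : t ^ (1 - τ - 1) = t ^ (-τ) := by ring_nf
  have e2 : t ^ (1 - τ) = t ^ (-τ) * t := by
    rw [← rpow_add_one ht.ne']; ring_nf
  simp only [Pi.add_apply, Pi.pow_apply, e1, e2]
  field_simp
  ring

theorem logCubeTail_sub_le {τ u v c : ℝ} (hτ : 1 < τ) (hu : 1 ≤ u) (huv : u ≤ v)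
    (hc : c ≤ u * (log u) ^ 3 / 4) :
    logCubeTail τ v - c * v ^ (-τ) ≤ logCubeTail τ u - c * u ^ (-τ) := by
  have hd : ∀ t ∈ Set.Ici u, HasDerivAt (fun t => logCubeTail τ t - c * t ^ (-τ))
      (-(τ / 4 * (log t) ^ 3 * t ^ (-τ)) - c * (-τ * t ^ (-τ - 1))) t := fun t ht => by
    have ht0 : 0 < t := by linarith [Set.mem_Ici.1 ht]
    exact (hasDerivAt_logCubeTail hτ ht0).sub
      ((hasDerivAt_rpow_const (Or.inl ht0.ne')).const_mul c)
  refine antitoneOn_of_deriv_nonpos (convex_Ici u)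
    (fun t ht => (hd t ht).continuousAt.continuousWithinAt)
    (fun t ht => (hd t (interior_subset ht)).differentiableAt.differentiableWithinAt)
    (fun t ht => ?_) (Set.mem_Ici.2 le_rfl) (Set.mem_Ici.2 huv) huv
  rw [(hd t (interior_subset ht)).deriv]
  have htu : u ≤ t := interior_subset ht
  have ht0 : 0 < t := by linarith
  have e : t ^ (-τ) = t ^ (-τ - 1) * t := by
    rw [← rpow_add_one ht0.ne']; ring_nf
  have hlog : 0 ≤ log u := log_nonneg hu
  have hmono : u * (log u) ^ 3 ≤ t * (log t) ^ 3 := by gcongr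
  have hpos : 0 ≤ τ * t ^ (-τ - 1) := by positivity
  rw [e]
  nlinarith [mul_nonneg hpos (show 0 ≤ t * (log t) ^ 3 / 4 - c by linarith)]

theorem mul_rpow_neg_le_logCubeTail {τ t : ℝ} (hτ : 1 < τ) (ht : 1 ≤ t) :
    t * (log t) ^ 3 / 4 * t ^ (-τ) ≤ logCubeTail τ t := by
  have ht0 : 0 < t := by linarith
  have hl : 0 ≤ log t := log_nonneg ht
  have hs : 0 < τ - 1 := sub_pos.2 hτ
  have e2 : t ^ (1 - τ) = t ^ (-τ) * t := by
    rw [← rpow_add_one ht0.ne']; ring_nf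
  have h1 : (log t) ^ 3 ≤ τ * ((log t) ^ 3 / (τ - 1)) := by
    rw [mul_div_assoc', le_div_iff₀ hs]
    nlinarith [pow_nonneg hl 3]
  have h2 : 0 ≤ τ * (3 * (log t) ^ 2 / (τ - 1) ^ 2 + 6 * log t / (τ - 1) ^ 3
      + 6 / (τ - 1) ^ 4) := by positivity
  have hp : 0 ≤ t * t ^ (-τ) / 4 := by positivity
  rw [logCubeTail, e2]
  nlinarith [mul_le_mul_of_nonneg_left (add_le_add h1 h2) hp]

/-- Partial summation against a majorant `t (log t)³ / 4` of the summatory function. -/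
theorem sum_mul_rpow_neg_le {τ : ℝ} (hτ : 1 < τ) {M : ℕ} (hM : 1 ≤ M) {a : ℕ → ℝ}
    (hA : ∀ N, M ≤ N → ∑ m ∈ Finset.Ico M (N + 1), a m ≤ N * (log N) ^ 3 / 4) (k : ℕ) :
    ∑ n ∈ Finset.Ico M (M + k), a n * (n : ℝ) ^ (-τ) ≤ logCubeTail τ M := by
  have key : ∀ k : ℕ, ∑ n ∈ Finset.Ico M (M + k), a n * (n : ℝ) ^ (-τ)
      ≤ logCubeTail τ M - logCubeTail τ ((M + k : ℕ) : ℝ)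
        + (∑ n ∈ Finset.Ico M (M + k), a n) * ((M + k : ℕ) : ℝ) ^ (-τ) := by
    intro k
    induction k with
    | zero => simp
    | succ k ih =>
      have hc := hA (M + k) (by omega)
      have hstep := logCubeTail_sub_le (u := ((M + k : ℕ) : ℝ)) (v := ((M + (k + 1) : ℕ) : ℝ)) hτ
        (by exact_mod_cast (by omega : 1 ≤ M + k)) (by push_cast; linarith) hc
      rw [← add_assoc] at hstep ⊢
      rw [Finset.sum_Ico_succ_top (by omega)] at hstep ⊢
      rw [Finset.sum_Ico_succ_top (by omega)]
      linarith
  refine (key k).trans ?_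
  have hMk : (1 : ℝ) ≤ ((M + k : ℕ) : ℝ) := by exact_mod_cast (by omega : 1 ≤ M + k)
  have hA' : ∑ n ∈ Finset.Ico M (M + k), a n
      ≤ ((M + k : ℕ) : ℝ) * (log ((M + k : ℕ) : ℝ)) ^ 3 / 4 := by
    have hl := log_nonneg hMk
    cases k with
    | zero => simp only [add_zero, Finset.Ico_self, Finset.sum_empty] at hl ⊢; positivity
    | succ k =>
      refine (hA (M + k) (by omega)).trans ?_
      have h1 : (1 : ℝ) ≤ ((M + k : ℕ) : ℝ) := by exact_mod_cast (by omega : 1 ≤ M + k)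
      have h2 : ((M + k : ℕ) : ℝ) ≤ ((M + (k + 1) : ℕ) : ℝ) := by push_cast; linarith
      have := log_nonneg h1
      gcongr
  have h3 := mul_le_mul_of_nonneg_right hA'
    (rpow_nonneg (by linarith : (0 : ℝ) ≤ ((M + k : ℕ) : ℝ)) (-τ))
  linarith [mul_rpow_neg_le_logCubeTail hτ hMk]

/-- The indicator function of the integers not divisible by `4`. -/
noncomputable def notFourDvd : ArithmeticFunction ℝ :=
  ⟨fun n => if 4 ∣ n then 0 else 1, by simp⟩

theorem notFourDvd_apply (n : ℕ) : notFourDvd n = if 4 ∣ n then 0 else 1 := rfl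

theorem isMultiplicative_notFourDvd : notFourDvd.IsMultiplicative := by
  refine ⟨by simp [notFourDvd_apply], fun {m n} h => ?_⟩
  have h4 : IsPrimePow 4 := (isPrimePow_nat_iff 4).2 ⟨2, 2, Nat.prime_two, by norm_num, by norm_num⟩
  simp only [notFourDvd_apply, h.isPrimePow_dvd_mul h4]
  by_cases h1 : 4 ∣ m <;> by_cases h2 : 4 ∣ n <;> simp [h1, h2]

theorem not_four_dvd_of_prime {p : ℕ} (hp : p.Prime) : ¬ 4 ∣ p := fun h => by
  rcases (Nat.dvd_prime hp).1 h with h | h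
  · omega
  · exact absurd (h ▸ hp) (by norm_num)

open ArithmeticFunction ArithmeticFunction.zeta in
theorem numDiv_sq_le_zeta_mul (n : ℕ) :
    (numDiv n : ℝ) ^ 2 ≤ ((((ζ : ArithmeticFunction ℝ) * (ζ * notFourDvd)) * ζ :
      ArithmeticFunction ℝ)) n := by
  have hz : (ζ : ArithmeticFunction ℝ).IsMultiplicative := isMultiplicative_zeta.natCast
  have hm := (hz.mul (hz.mul isMultiplicative_notFourDvd)).mul hz
  induction n using Nat.recOnPosPrimePosCoprime with
  | zero => simp [numDiv]
  | one => rw [hm.1]; simp [numDiv]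
  | prime_pow p e hp he =>
    have h1 : ∀ i : ℕ, (if i = 0 then 1 else 2 : ℝ)
        ≤ ((ζ : ArithmeticFunction ℝ) * notFourDvd) (p ^ i) := by
      intro i
      rw [coe_zeta_mul_apply, Nat.sum_divisors_prime_pow hp]
      have hnn : ∀ j, 0 ≤ notFourDvd j := fun j => by rw [notFourDvd_apply]; split_ifs <;> norm_num
      rcases i with _ | i
      · simp [notFourDvd_apply]
      · rw [Finset.sum_range_succ', Finset.sum_range_succ']
        have := Finset.sum_nonneg (s := Finset.range i) fun j _ => hnn (p ^ (j + 1 + 1))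
        simp only [notFourDvd_apply, not_four_dvd_of_prime hp, zero_add, pow_one,
          pow_zero] at this ⊢
        norm_num at this ⊢
        linarith
    have h2 : ∀ i : ℕ, (2 * i + 1 : ℝ)
        ≤ ((ζ : ArithmeticFunction ℝ) * (ζ * notFourDvd)) (p ^ i) := by
      intro i
      rw [coe_zeta_mul_apply, Nat.sum_divisors_prime_pow hp]
      refine le_trans (le_of_eq ?_) (Finset.sum_le_sum fun j _ => h1 j)
      rw [Finset.sum_range_succ']
      simp
      ring
    rw [coe_mul_zeta_apply, Nat.sum_divisors_prime_pow hp, numDiv, Nat.divisors_prime_pow hp]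
    refine le_trans (le_of_eq ?_) (Finset.sum_le_sum fun j _ => h2 j)
    rw [Finset.card_map, Finset.card_range]
    clear h1 h2 he
    induction e with
    | zero => simp
    | succ e ih => rw [Finset.sum_range_succ, ← ih]; push_cast; ring
  | coprime a b _ _ hab iha ihb =>
    rw [hm.2 hab, numDiv, hab.card_divisors_mul]
    push_cast
    rw [mul_pow]
    exact mul_le_mul iha ihb (by positivity)
      ((by positivity : (0 : ℝ) ≤ (numDiv a : ℝ) ^ 2).trans iha)

/-- The arithmetic function `n ↦ f n / n`. -/
noncomputable def divId (f : ArithmeticFunction ℝ) : ArithmeticFunction ℝ :=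
  ⟨fun n => f n / n, by simp⟩

theorem divId_apply (f : ArithmeticFunction ℝ) (n : ℕ) : divId f n = f n / n := rfl

theorem divId_mul (f g : ArithmeticFunction ℝ) : divId (f * g) = divId f * divId g := by
  ext n
  rw [divId_apply, ArithmeticFunction.mul_apply, ArithmeticFunction.mul_apply, Finset.sum_div]
  refine Finset.sum_congr rfl fun x hx => ?_
  rw [divId_apply, divId_apply, ← (Nat.mem_divisorsAntidiagonal.1 hx).1, div_mul_div_comm]
  push_cast
  rfl

open ArithmeticFunction ArithmeticFunction.zeta in
theorem sum_divId_zeta_mul (f : ArithmeticFunction ℝ) (N : ℕ) :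
    ∑ n ∈ Finset.Ioc 0 N, divId (ζ * f) n
      = ∑ a ∈ Finset.Ioc 0 N, (1 / a : ℝ) * ∑ m ∈ Finset.Ioc 0 (N / a), divId f m := by
  rw [divId_mul, sum_Ioc_mul_eq_sum_sum]
  refine Finset.sum_congr rfl fun a ha => ?_
  have : a ≠ 0 := (Finset.mem_Ioc.1 ha).1.ne'
  simp [divId_apply, this]

open ArithmeticFunction ArithmeticFunction.zeta in
theorem sum_numDiv_sq_le_mul_sum_divId (N : ℕ) :
    ∑ n ∈ Finset.Ioc 0 N, (numDiv n : ℝ) ^ 2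
      ≤ N * ∑ n ∈ Finset.Ioc 0 N, divId (ζ * (ζ * notFourDvd)) n := by
  refine (Finset.sum_le_sum fun n _ => numDiv_sq_le_zeta_mul n).trans ?_
  rw [sum_Ioc_mul_zeta_eq_sum, Finset.mul_sum]
  refine Finset.sum_le_sum fun n _ => ?_
  have h0 : 0 ≤ ((ζ : ArithmeticFunction ℝ) * (ζ * notFourDvd)) n := by
    rw [coe_zeta_mul_apply]
    refine Finset.sum_nonneg fun i _ => ?_
    rw [coe_zeta_mul_apply]
    refine Finset.sum_nonneg fun j _ => ?_
    rw [notFourDvd_apply]; split_ifs <;> norm_num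
  rw [divId_apply, mul_div_assoc', mul_comm (N : ℝ), mul_div_assoc]
  exact mul_le_mul_of_nonneg_left Nat.cast_div_le h0

theorem two_mul_add_cube_le_log_div {x : ℝ} (h0 : 0 ≤ x) (h1 : x < 1) :
    2 * x + 2 * x ^ 3 / 3 ≤ log ((1 + x) / (1 - x)) := by
  have h := sum_range_le_log_div h0 h1 2
  norm_num [Finset.sum_range_succ] at h
  linarith

theorem inv_le_log_add_half_sub_log_sub_half {a : ℝ} (ha : 1 ≤ a) :
    1 / a ≤ log (a + 1 / 2) - log (a - 1 / 2) := by
  have h0 : 0 ≤ 1 / (2 * a) := by positivity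
  have h1 : 1 / (2 * a) < 1 := by rw [div_lt_one (by positivity)]; linarith
  have h := two_mul_add_cube_le_log_div h0 h1
  rw [← log_div (by linarith) (by linarith)]
  have e : (1 + 1 / (2 * a)) / (1 - 1 / (2 * a)) = (a + 1 / 2) / (a - 1 / 2) := by
    have : 2 * a - 1 ≠ 0 := by linarith
    have : a - 1 / 2 ≠ 0 := by linarith
    have : 1 - 1 / (2 * a) ≠ 0 := by linarith
    field_simp
  rw [e] at h
  have : 2 * (1 / (2 * a)) = 1 / a := by field_simp
  have h3 : 0 ≤ 2 * (1 / (2 * a)) ^ 3 / 3 := by positivity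
  linarith

theorem log_add_half_add_log_sub_half_le {a : ℝ} (ha : 1 ≤ a) :
    log (a + 1 / 2) + log (a - 1 / 2) ≤ 2 * log a := by
  rw [← log_mul (by linarith) (by linarith), two_mul, ← log_mul (by linarith) (by linarith)]
  exact log_le_log (by nlinarith) (by nlinarith)

theorem log_three_halves_bounds : 0.405 ≤ log (3 / 2) ∧ log (3 / 2) ≤ 0.4056 := by
  have h1 := two_mul_add_cube_le_log_div (x := 1 / 5) (by norm_num) (by norm_num)
  have h2 := two_mul_add_cube_le_log_div (x := 1 / 7) (by norm_num) (by norm_num)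
  have h3 : log (3 / 2) = log 2 - log (4 / 3) := by
    rw [← log_div (by norm_num) (by norm_num)]; norm_num
  have h4 := log_two_lt_d9
  norm_num at h1 h2 h4 ⊢
  constructor <;> linarith

theorem log_floor_add_half_le {y : ℝ} (hy : 1 ≤ y) :
    log ((⌊y⌋₊ : ℝ) + 1 / 2) ≤ log y + 1 / 2 / y := by
  have hy0 : 0 < y := by linarith
  have h := log_le_sub_one_of_pos (show 0 < ((⌊y⌋₊ : ℝ) + 1 / 2) / y by positivity)
  rw [log_div (by positivity) hy0.ne'] at h
  have h2 : (⌊y⌋₊ : ℝ) / y ≤ 1 := (div_le_one hy0).2 (Nat.floor_le hy0.le)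
  rw [add_div] at h
  linarith

theorem sum_inv_le {n : ℕ} (hn : 1 ≤ n) :
    ∑ a ∈ Finset.Ioc 0 n, (1 / a : ℝ) ≤ 1 + (log (n + 1 / 2) - log (3 / 2)) := by
  induction n, hn using Nat.le_induction with
  | base => norm_num
  | succ n hn ih =>
    rw [Finset.sum_Ioc_succ_top (by omega)]
    have h := inv_le_log_add_half_sub_log_sub_half (a := ((n + 1 : ℕ) : ℝ))
      (by exact_mod_cast (by omega : 1 ≤ n + 1))
    have e : ((n + 1 : ℕ) : ℝ) - 1 / 2 = n + 1 / 2 := by push_cast; ring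
    rw [e] at h
    linarith

theorem sum_inv_mul_sub_log_le {l : ℝ} {n : ℕ} (hn : 1 ≤ n) (hl : log n ≤ l) :
    ∑ a ∈ Finset.Ioc 0 n, (1 / a : ℝ) * (l - log a)
      ≤ l + ((l - log (3 / 2)) ^ 2 - (l - log (n + 1 / 2)) ^ 2) / 2 := by
  induction n, hn using Nat.le_induction with
  | base => norm_num
  | succ n hn ih =>
    have hn0 : (0 : ℝ) < n := by exact_mod_cast hn
    specialize ih ((log_le_log hn0 (by push_cast; linarith)).trans hl)
    rw [Finset.sum_Ioc_succ_top (by omega)]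
    have h1 : (1 : ℝ) ≤ ((n + 1 : ℕ) : ℝ) := by exact_mod_cast (by omega : 1 ≤ n + 1)
    have h := inv_le_log_add_half_sub_log_sub_half h1
    have h' := log_add_half_add_log_sub_half_le h1
    have e : ((n + 1 : ℕ) : ℝ) - 1 / 2 = n + 1 / 2 := by push_cast; ring
    rw [e] at h h'
    have hp : (0 : ℝ) ≤ 1 / ((n + 1 : ℕ) : ℝ) := by positivity
    have := mul_le_mul h (show l - log ((n + 1 : ℕ) : ℝ)
      ≤ l - (log (((n + 1 : ℕ) : ℝ) + 1 / 2) + log (n + 1 / 2)) / 2 by linarith)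
      (by linarith) (hp.trans h)
    linarith

theorem sum_inv_mul_sub_log_sq_le {l : ℝ} {n : ℕ} (hn : 1 ≤ n) (hl : log n ≤ l) :
    ∑ a ∈ Finset.Ioc 0 n, (1 / a : ℝ) * (l - log a) ^ 2
      ≤ l ^ 2 + ((l - log (3 / 2)) ^ 3 - (l - log (n + 1 / 2)) ^ 3) / 3 := by
  induction n, hn using Nat.le_induction with
  | base => norm_num
  | succ n hn ih =>
    have hn0 : (0 : ℝ) < n := by exact_mod_cast hn
    specialize ih ((log_le_log hn0 (by push_cast; linarith)).trans hl)
    rw [Finset.sum_Ioc_succ_top (by omega)]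
    have h1 : (1 : ℝ) ≤ ((n + 1 : ℕ) : ℝ) := by exact_mod_cast (by omega : 1 ≤ n + 1)
    have h := inv_le_log_add_half_sub_log_sub_half h1
    have h' := log_add_half_add_log_sub_half_le h1
    have e : ((n + 1 : ℕ) : ℝ) - 1 / 2 = n + 1 / 2 := by push_cast; ring
    rw [e] at h h'
    have hp : (0 : ℝ) ≤ 1 / ((n + 1 : ℕ) : ℝ) := by positivity
    have hm : (l - log ((n + 1 : ℕ) : ℝ)) ^ 2
        ≤ (l - (log (((n + 1 : ℕ) : ℝ) + 1 / 2) + log (n + 1 / 2)) / 2) ^ 2 :=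
      pow_le_pow_left₀ (by linarith) (by linarith) 2
    have h2 := mul_le_mul h hm (sq_nonneg _) (hp.trans h)
    have h3 := pow_nonneg (hp.trans h) 3
    nlinarith

theorem one_le_floor {y : ℝ} (hy : 1 ≤ y) : 1 ≤ ⌊y⌋₊ := (Nat.one_le_floor_iff y).2 hy

theorem log_floor_le {y : ℝ} (hy : 1 ≤ y) : log (⌊y⌋₊ : ℝ) ≤ log y :=
  log_le_log (by exact_mod_cast one_le_floor hy) (Nat.floor_le (by linarith))

theorem sum_inv_floor_le {y : ℝ} (hy : 1 ≤ y) :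
    ∑ a ∈ Finset.Ioc 0 ⌊y⌋₊, (1 / a : ℝ) ≤ log y + 0.595 + 1 / 2 / y := by
  have := sum_inv_le (one_le_floor hy)
  have := log_floor_add_half_le hy
  have := log_three_halves_bounds.1
  norm_num at *
  linarith

theorem sum_inv_mul_log_le {y : ℝ} (hy : 1 ≤ y) :
    ∑ a ∈ Finset.Ioc 0 ⌊y⌋₊, (1 / a : ℝ) * (log y - log a)
      ≤ (log y) ^ 2 / 2 + 0.595 * log y + 0.0823 := by
  have h := sum_inv_mul_sub_log_le (one_le_floor hy) (log_floor_le hy)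
  obtain ⟨h1, h2⟩ := log_three_halves_bounds
  have hl := log_nonneg hy
  have h3 := sq_nonneg (log y - log (⌊y⌋₊ + 1 / 2))
  have h4 := mul_nonneg hl (sub_nonneg.2 h1)
  have h5 : (log (3 / 2)) ^ 2 ≤ 0.4056 ^ 2 := pow_le_pow_left₀ (by norm_num at *; linarith) h2 2
  norm_num at *
  linarith

theorem sum_inv_mul_log_sq_le {y : ℝ} (hy : 1 ≤ y) :
    ∑ a ∈ Finset.Ioc 0 ⌊y⌋₊, (1 / a : ℝ) * (log y - log a) ^ 2
      ≤ (log y) ^ 3 / 3 + 0.595 * (log y) ^ 2 + 0.1646 * log y + 0.0196 := by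
  have h := sum_inv_mul_sub_log_sq_le (one_le_floor hy) (log_floor_le hy)
  obtain ⟨h1, h2⟩ := log_three_halves_bounds
  have hl := log_nonneg hy
  have hu : -(1 / 2) ≤ log y - log (⌊y⌋₊ + 1 / 2) := by
    have := log_floor_add_half_le hy
    have : 1 / 2 / y ≤ 1 / 2 := div_le_self (by norm_num) hy
    linarith
  have h3 : -(1 / 8) ≤ (log y - log (⌊y⌋₊ + 1 / 2)) ^ 3 := by
    have := (Odd.strictMono_pow (R := ℝ) (by decide : Odd 3)).monotone hu
    norm_num at this ⊢
    exact this
  have h4 := mul_nonneg (sq_nonneg (log y)) (sub_nonneg.2 h1)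
  have h5 : (log (3 / 2)) ^ 2 ≤ 0.4056 ^ 2 := pow_le_pow_left₀ (by norm_num at *; linarith) h2 2
  have h6 := mul_le_mul_of_nonneg_left h5 hl
  have h7 : 0.405 ^ 3 ≤ (log (3 / 2)) ^ 3 := pow_le_pow_left₀ (by norm_num) h1 3
  norm_num at *
  linarith

theorem sum_divId_notFourDvd_succ (n : ℕ) :
    ∑ k ∈ Finset.Ioc 0 (n + 1), divId notFourDvd k
      = ∑ k ∈ Finset.Ioc 0 n, divId notFourDvd k
        + if 4 ∣ n + 1 then 0 else 1 / ((n : ℝ) + 1) := by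
  rw [Finset.sum_Ioc_succ_top (Nat.zero_le _), divId_apply, notFourDvd_apply]
  split_ifs <;> simp

theorem sum_divId_notFourDvd_four_mul_le {q : ℕ} (hq : 1 ≤ q) :
    ∑ k ∈ Finset.Ioc 0 (4 * q), divId notFourDvd k ≤ 3 / 4 * log q + 11 / 6 := by
  induction q, hq using Nat.le_induction with
  | base => norm_num [Finset.sum_Ioc_succ_top, divId_apply, notFourDvd_apply]
  | succ q hq ih =>
    have hq1 : (1 : ℝ) ≤ q := by exact_mod_cast hq
    have h0 : (0 : ℝ) ≤ 1 / (2 * q + 1) := by positivity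
    have h1 : 1 / (2 * q + 1 : ℝ) < 1 := by rw [div_lt_one (by positivity)]; linarith
    have h := two_mul_add_cube_le_log_div h0 h1
    have e : (1 + 1 / (2 * q + 1 : ℝ)) / (1 - 1 / (2 * q + 1 : ℝ)) = (q + 1) / q := by
      have : (1 : ℝ) - 1 / (2 * q + 1 : ℝ) ≠ 0 := by linarith
      have : (2 * q + 1 : ℝ) - 1 ≠ 0 := by linarith
      field_simp
      ring
    rw [e, log_div (by positivity) (by positivity)] at h
    rw [show 4 * (q + 1) = 4 * q + 1 + 1 + 1 + 1 by ring]
    simp only [sum_divId_notFourDvd_succ, if_neg (show ¬ 4 ∣ 4 * q + 1 by omega),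
      if_neg (show ¬ 4 ∣ 4 * q + 1 + 1 by omega), if_neg (show ¬ 4 ∣ 4 * q + 1 + 1 + 1 by omega),
      if_pos (show 4 ∣ 4 * q + 1 + 1 + 1 + 1 by omega)]
    push_cast
    have key : 1 / (4 * q + 1 : ℝ) + 1 / (4 * q + 1 + 1) + 1 / (4 * q + 1 + 1 + 1)
        ≤ 3 / 4 * (2 * (1 / (2 * q + 1 : ℝ)) + 2 * (1 / (2 * q + 1 : ℝ)) ^ 3 / 3) := by
      rw [div_add_div _ _ (by positivity) (by positivity),
        div_add_div _ _ (by positivity) (by positivity)]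
      have e2 : 3 / 4 * (2 * (1 / (2 * q + 1 : ℝ)) + 2 * (1 / (2 * q + 1 : ℝ)) ^ 3 / 3)
          = (3 * (2 * q + 1) ^ 2 + 1) / (2 * (2 * q + 1) ^ 3) := by
        field_simp
        ring
      rw [e2, div_le_div_iff₀ (by positivity) (by positivity)]
      have : (0 : ℝ) ≤ q := by linarith
      ring_nf
      nlinarith [pow_nonneg this 2, pow_nonneg this 3, pow_nonneg this 4, pow_nonneg this 5]
    rw [show (4 * q + 2 + 1 : ℝ) = 4 * q + 1 + 1 + 1 by ring]
    linarith

theorem sum_divId_notFourDvd_le {y : ℝ} (hy : 1 ≤ y) :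
    ∑ k ∈ Finset.Ioc 0 ⌊y⌋₊, divId notFourDvd k ≤ 3 / 4 * log y + 0.794 + 3 / 4 / y := by
  have hy0 : 0 < y := by linarith
  have hle := Nat.floor_le hy0.le
  have hlog2 := log_two_gt_d9
  have hlow : ∀ c : ℝ, 0 < c → log c + 1 - c / y ≤ log y := fun c hc => by
    have h := one_sub_inv_le_log_of_pos (show 0 < y / c by positivity)
    rw [log_div hy0.ne' hc.ne', inv_div] at h
    linarith
  have hlog4 : log 4 = 2 * log 2 := by
    rw [show (4 : ℝ) = 2 ^ 2 by norm_num, log_pow]; norm_num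
  obtain ⟨q, r, hr, hn⟩ : ∃ q r, r < 4 ∧ ⌊y⌋₊ = 4 * q + r :=
    ⟨⌊y⌋₊ / 4, ⌊y⌋₊ % 4, Nat.mod_lt _ (by norm_num), (Nat.div_add_mod _ _).symm⟩
  have h1n := one_le_floor hy
  rw [hn] at hle h1n ⊢
  push_cast at hle
  have hyinv : 3 / 4 / y = 3 / 4 * (1 / y) := by ring
  rw [hyinv]
  have hyp : 0 < 1 / y := by positivity
  by_cases hr3 : r = 3
  · subst hr3
    have hq := sum_divId_notFourDvd_four_mul_le (q := q + 1) (by omega)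
    rw [show 4 * (q + 1) = 4 * q + 3 + 1 by ring, sum_divId_notFourDvd_succ,
      if_pos (show 4 ∣ 4 * q + 3 + 1 by omega)] at hq
    have h := hlow (4 * (q + 1)) (by positivity)
    rw [log_mul (by norm_num) (by positivity), hlog4] at h
    have h2 : 4 * (q + 1 : ℝ) / y ≤ 1 + 1 / y := by
      rw [div_le_iff₀ hy0, add_mul, one_div_mul_cancel hy0.ne']
      push_cast at hle
      linarith
    generalize 4 * (q + 1 : ℝ) / y = z at h h2
    push_cast at hq
    norm_num only at hlog2 ⊢
    linarith
  rcases Nat.eq_zero_or_pos q with rfl | hq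
  · have hr' : r = 1 ∨ r = 2 := by omega
    rcases hr' with rfl | rfl
    · have h := hlow 1 one_pos
      norm_num [divId_apply, notFourDvd_apply] at h ⊢
      linarith
    · have h := hlow 2 two_pos
      have h2 : 1 / y ≤ 1 / 2 := one_div_le_one_div_of_le two_pos (by simpa using hle)
      rw [show (2 : ℝ) / y = 2 * (1 / y) by ring] at h
      norm_num [divId_apply, notFourDvd_apply, Finset.sum_Ioc_succ_top] at h h2 ⊢
      linarith
  · have hq1 : (1 : ℝ) ≤ q := by exact_mod_cast hq
    have hB := sum_divId_notFourDvd_four_mul_le hq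
    have h := hlow (4 * q) (by positivity)
    rw [log_mul (by norm_num) (by positivity), hlog4,
      show 4 * (q : ℝ) / y = 4 * q * (1 / y) by ring] at h
    have hr' : r = 0 ∨ r = 1 ∨ r = 2 := by omega
    have hinv : (4 * q - 1 : ℝ) * (1 / y) ≤ (4 * q - 1 : ℝ) * (1 / (4 * q + r)) :=
      mul_le_mul_of_nonneg_left (one_div_le_one_div_of_le (by positivity) hle) (by linarith)
    have hfrac : (4 * q - 1 : ℝ) * (1 / (4 * q + r)) = 1 - (r + 1) * (1 / (4 * q + r)) := by
      field_simp
      ring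
    rcases hr' with rfl | rfl | rfl
    · have : 0 < 1 / (4 * q + (0 : ℕ) : ℝ) := by positivity
      push_cast at hinv hfrac this
      rw [add_zero]
      norm_num only at hlog2 ⊢
      linarith
    · rw [sum_divId_notFourDvd_succ, if_neg (show ¬ 4 ∣ 4 * q + 1 by omega)]
      have : 0 < 1 / (4 * q + 1 : ℝ) := by positivity
      push_cast at hinv hfrac ⊢
      norm_num only at hlog2 ⊢
      linarith
    · rw [show 4 * q + 2 = 4 * q + 1 + 1 by ring]
      rw [sum_divId_notFourDvd_succ, sum_divId_notFourDvd_succ,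
        if_neg (show ¬ 4 ∣ 4 * q + 1 by omega), if_neg (show ¬ 4 ∣ 4 * q + 1 + 1 by omega)]
      have : 1 / (4 * q + 1 : ℝ) ≤ 5 / 4 * (1 / (4 * q + 2)) := by
        rw [mul_one_div, div_le_div_iff₀ (by positivity) (by positivity)]
        linarith
      push_cast at hinv hfrac ⊢
      rw [show (4 * q + 1 + 1 : ℝ) = 4 * q + 2 by ring]
      norm_num only at hlog2 ⊢
      linarith

theorem le_div_of_mem_Ioc_floor {y : ℝ} (hy : 1 ≤ y) {a : ℕ} (ha : a ∈ Finset.Ioc 0 ⌊y⌋₊) :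
    (0 : ℝ) < a ∧ 1 ≤ y / a ∧ log (y / a) = log y - log a := by
  obtain ⟨h1, h2⟩ := Finset.mem_Ioc.1 ha
  have h0 : (0 : ℝ) < a := by exact_mod_cast h1
  refine ⟨h0, (one_le_div h0).2 ?_, log_div (by linarith) h0.ne'⟩
  exact (Nat.le_floor_iff (by linarith)).1 h2

theorem sum_one_div_mul_div_le {y : ℝ} (hy : 1 ≤ y) (c : ℝ) (hc : 0 ≤ c) :
    ∑ a ∈ Finset.Ioc 0 ⌊y⌋₊, (1 / a : ℝ) * (c / (y / a)) ≤ c := by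
  have hy0 : 0 < y := by linarith
  have h : ∀ a ∈ Finset.Ioc 0 ⌊y⌋₊, (1 / a : ℝ) * (c / (y / a)) = c / y := fun a ha => by
    have := (le_div_of_mem_Ioc_floor hy ha).1
    field_simp
  rw [Finset.sum_congr rfl h, Finset.sum_const, Nat.card_Ioc, nsmul_eq_mul, Nat.sub_zero,
    mul_div_assoc', div_le_iff₀ hy0, mul_comm]
  exact mul_le_mul_of_nonneg_left (Nat.floor_le hy0.le) hc

open ArithmeticFunction.zeta in
theorem sum_divId_zeta_notFourDvd_le {y : ℝ} (hy : 1 ≤ y) :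
    ∑ k ∈ Finset.Ioc 0 ⌊y⌋₊, divId (ζ * notFourDvd) k
      ≤ 0.375 * (log y) ^ 2 + 1.2403 * log y + 1.2843 + 0.397 / y := by
  rw [sum_divId_zeta_mul]
  have h : ∀ a ∈ Finset.Ioc 0 ⌊y⌋₊,
      (1 / a : ℝ) * ∑ m ∈ Finset.Ioc 0 (⌊y⌋₊ / a), divId notFourDvd m
        ≤ 3 / 4 * ((1 / a : ℝ) * (log y - log a)) + 0.794 * (1 / a : ℝ)
          + (1 / a : ℝ) * (3 / 4 / (y / a)) := fun a ha => by
    obtain ⟨h0, h1, h2⟩ := le_div_of_mem_Ioc_floor hy ha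
    have := mul_le_mul_of_nonneg_left (sum_divId_notFourDvd_le h1) (one_div_pos.2 h0).le
    rw [Nat.floor_div_natCast, h2] at this
    linarith
  refine (Finset.sum_le_sum h).trans ?_
  rw [Finset.sum_add_distrib, Finset.sum_add_distrib, ← Finset.mul_sum, ← Finset.mul_sum]
  have h0 := sum_inv_floor_le hy
  have h1 := sum_inv_mul_log_le hy
  have h2 := sum_one_div_mul_div_le hy (3 / 4) (by norm_num)
  have hl := log_nonneg hy
  have e1 : 1 / 2 / y = 1 / 2 * (1 / y) := by ring
  have e2 : 0.397 / y = 0.397 * (1 / y) := by ring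
  rw [e1] at h0
  rw [e2]
  norm_num at *
  linarith

open ArithmeticFunction.zeta in
theorem sum_divId_zeta_zeta_notFourDvd_le {y : ℝ} (hy : 1 ≤ y) :
    ∑ k ∈ Finset.Ioc 0 ⌊y⌋₊, divId (ζ * (ζ * notFourDvd)) k
      ≤ 0.125 * (log y) ^ 3 + 0.844 * (log y) ^ 2 + 2.085 * log y + 2 := by
  rw [sum_divId_zeta_mul]
  have h : ∀ a ∈ Finset.Ioc 0 ⌊y⌋₊,
      (1 / a : ℝ) * ∑ m ∈ Finset.Ioc 0 (⌊y⌋₊ / a), divId (ζ * notFourDvd) m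
        ≤ 0.375 * ((1 / a : ℝ) * (log y - log a) ^ 2) + 1.2403 * ((1 / a : ℝ) * (log y - log a))
          + 1.2843 * (1 / a : ℝ) + (1 / a : ℝ) * (0.397 / (y / a)) := fun a ha => by
    obtain ⟨h0, h1, h2⟩ := le_div_of_mem_Ioc_floor hy ha
    have := mul_le_mul_of_nonneg_left (sum_divId_zeta_notFourDvd_le h1) (one_div_pos.2 h0).le
    rw [Nat.floor_div_natCast, h2] at this
    linarith
  refine (Finset.sum_le_sum h).trans ?_
  rw [Finset.sum_add_distrib, Finset.sum_add_distrib, Finset.sum_add_distrib, ← Finset.mul_sum,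
    ← Finset.mul_sum, ← Finset.mul_sum]
  have h0 := sum_inv_floor_le hy
  have h1 := sum_inv_mul_log_le hy
  have h2 := sum_inv_mul_log_sq_le hy
  have h3 := sum_one_div_mul_div_le hy 0.397 (by norm_num)
  have hl := log_nonneg hy
  have hl2 := sq_nonneg (log y)
  have h4 : 1 / 2 / y ≤ 1 / 2 := div_le_self (by norm_num) hy
  norm_num at *
  linarith

theorem sum_numDiv_sq_le_of_large {N : ℕ} (hN : 2 ^ 13 ≤ N) :
    ∑ n ∈ Finset.Ioc 0 N, (numDiv n : ℝ) ^ 2 ≤ N * (log N) ^ 3 / 4 := by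
  have hN1 : (1 : ℝ) ≤ N := by exact_mod_cast (by omega : 1 ≤ N)
  have h := sum_divId_zeta_zeta_notFourDvd_le hN1
  rw [Nat.floor_natCast] at h
  have hl : 9 ≤ log N := by
    have h1 : log ((2 : ℝ) ^ 13) ≤ log N := log_le_log (by norm_num) (by exact_mod_cast hN)
    rw [log_pow] at h1
    have := log_two_gt_d9
    norm_num at *
    linarith
  have hpoly : 0.125 * (log N) ^ 3 + 0.844 * (log N) ^ 2 + 2.085 * log N + 2
      ≤ (log N) ^ 3 / 4 := by
    have := mul_nonneg (sq_nonneg (log N)) (sub_nonneg.2 hl)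
    norm_num
    nlinarith
  rw [mul_div_assoc]
  exact (sum_numDiv_sq_le_mul_sum_divId N).trans
    (mul_le_mul_of_nonneg_left (h.trans hpoly) (by linarith))

/-- The number of divisors of `n` among `1, …, s`, in a form that the kernel evaluates quickly. -/
def smallDivCount (n s : ℕ) : ℕ :=
  Nat.rec 0 (fun j ih => Nat.add ih (Nat.sub 1 (Nat.mod n (Nat.succ j)))) s

theorem smallDivCount_eq (n s : ℕ) :
    smallDivCount n s = ((Finset.range s).filter fun j => j + 1 ∣ n).card := by
  induction s with
  | zero => rfl
  | succ s ih =>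
    have h : smallDivCount n (s + 1) = smallDivCount n s + (1 - n % (s + 1)) := rfl
    rw [h, ih, Finset.range_add_one, Finset.filter_insert]
    by_cases hd : s + 1 ∣ n
    · rw [if_pos hd, Finset.card_insert_of_notMem (by simp), Nat.mod_eq_zero_of_dvd hd]
    · have : n % (s + 1) ≠ 0 := fun h => hd (Nat.dvd_of_mod_eq_zero h)
      rw [if_neg hd]
      omega

theorem numDiv_le_two_mul_smallDivCount {n s : ℕ} (hs : n < (s + 1) ^ 2) :
    numDiv n ≤ 2 * smallDivCount n s := by
  set D := (Finset.range s).filter fun j => j + 1 ∣ n with hD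
  have hsub : n.divisors ⊆ D.image (fun j => j + 1) ∪ D.image (fun j => n / (j + 1)) := by
    intro d hd
    obtain ⟨⟨e, rfl⟩, hn⟩ := Nat.mem_divisors.1 hd
    obtain ⟨hd0, he0⟩ := mul_ne_zero_iff.1 hn
    simp only [Finset.mem_union, Finset.mem_image, hD, Finset.mem_filter, Finset.mem_range]
    by_cases h : d ≤ s
    · exact Or.inl ⟨d - 1, ⟨by omega, by simp [Nat.sub_add_cancel (Nat.pos_of_ne_zero hd0)]⟩,
        by omega⟩
    · have he : e ≤ s := by
        by_contra he
        nlinarith [Nat.mul_le_mul (not_le.1 h) (not_le.1 he)]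
      have h1 : e - 1 + 1 = e := by omega
      refine Or.inr ⟨e - 1, ⟨by omega, by simp [h1]⟩, ?_⟩
      rw [h1, Nat.mul_div_cancel _ (Nat.pos_of_ne_zero he0)]
  rw [smallDivCount_eq, two_mul]
  exact (Finset.card_le_card hsub).trans ((Finset.card_union_le _ _).trans
    (add_le_add Finset.card_image_le Finset.card_image_le))

/-- An upper bound for the sum of `numDiv n ^ 2` over `start ≤ n < start + len`. -/
def blockSum (s start len : ℕ) : ℕ :=
  Nat.rec 0 (fun j ih =>
    Nat.add ih (Nat.pow (Nat.mul 2 (smallDivCount (Nat.add start j) s)) 2)) len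

theorem sum_numDiv_sq_le_blockSum {s start len : ℕ} (hs : start + len ≤ (s + 1) ^ 2) :
    ∑ n ∈ Finset.Ico start (start + len), numDiv n ^ 2 ≤ blockSum s start len := by
  induction len with
  | zero => simp
  | succ len ih =>
    have h : blockSum s start (len + 1)
        = blockSum s start len + (2 * smallDivCount (start + len) s) ^ 2 := rfl
    rw [h, ← add_assoc, Finset.sum_Ico_succ_top (by omega)]
    exact add_le_add (ih (by omega))
      (Nat.pow_le_pow_left (numDiv_le_two_mul_smallDivCount (by omega)) 2)

/-- Checks the bound for the partial sums of `numDiv n ^ 2` on consecutive blocks `[lo, hi)`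
up to `top`. Each block is given by `(hi, s, T)`, where `T` bounds the sum up to `hi`,
and `2 ^ (a / 8) ≤ lo` bounds `log lo` from below. -/
def checkBlocks (top : ℕ) : ℕ → ℕ → ℕ → List (ℕ × ℕ × ℕ) → Bool
  | _, lo, _, [] => Nat.ble top lo
  | a, lo, T, (hi, s, T') :: l =>
    Nat.ble (2 ^ a) (lo ^ 8) && Nat.ble hi ((s + 1) ^ 2) && Nat.ble lo hi
      && Nat.ble (T + blockSum s lo (hi - lo)) T'
      && Nat.ble (4 * 80000 ^ 3 * T') (lo * (6931 * a) ^ 3)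
      && checkBlocks top (a + 1) hi T' l

theorem le_mul_log_cube_of_two_pow_le {a lo T N : ℕ} (hN : lo ≤ N) (ha : 2 ^ a ≤ lo ^ 8)
    (hT : 4 * 80000 ^ 3 * T ≤ lo * (6931 * a) ^ 3) :
    (T : ℝ) ≤ N * (log N) ^ 3 / 4 := by
  have hlo : 0 < lo := Nat.pos_of_ne_zero fun h => by
    have := Nat.one_le_two_pow (n := a)
    rw [h] at ha
    omega
  have hlo' : (0 : ℝ) < lo := by exact_mod_cast hlo
  have hNlo : (lo : ℝ) ≤ N := by exact_mod_cast hN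
  have h1 : log ((2 : ℝ) ^ a) ≤ log ((lo : ℝ) ^ 8) :=
    log_le_log (by positivity) (by exact_mod_cast ha)
  rw [log_pow, log_pow] at h1
  have h2 := log_le_log hlo' hNlo
  have h3 : (a : ℝ) * (6931 / 10000) ≤ a * log 2 := by
    have := log_two_gt_d9
    gcongr
    norm_num at this ⊢
    linarith
  have h4 : (6931 * a / 80000 : ℝ) ≤ log N := by
    push_cast at h1
    linarith
  have h5 : (6931 * a / 80000 : ℝ) ^ 3 ≤ (log N) ^ 3 := pow_le_pow_left₀ (by positivity) h4 3
  have h6 : (4 * 80000 ^ 3 * T : ℝ) ≤ lo * (6931 * a) ^ 3 := by exact_mod_cast hT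
  have h7 := mul_le_mul hNlo h5 (by positivity) (hlo'.le.trans hNlo)
  rw [div_pow] at h7
  linarith

theorem sum_numDiv_sq_le_of_checkBlocks {m top : ℕ} (l : List (ℕ × ℕ × ℕ)) :
    ∀ {a lo T : ℕ}, checkBlocks top a lo T l = true → m ≤ lo →
      ∑ n ∈ Finset.Ico m lo, numDiv n ^ 2 ≤ T → ∀ N, lo ≤ N → N < top →
      ∑ n ∈ Finset.Ico m (N + 1), (numDiv n : ℝ) ^ 2 ≤ N * (log N) ^ 3 / 4 := by
  induction l with
  | nil =>
    intro a lo T h _ _ N hN hNt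
    have := Nat.le_of_ble_eq_true h
    omega
  | cons b l ih =>
    obtain ⟨hi, s, T'⟩ := b
    intro a lo T h hm hT N hN hNt
    simp only [checkBlocks, Bool.and_eq_true, Nat.ble_eq] at h
    obtain ⟨⟨⟨⟨⟨h1, h2⟩, h3⟩, h4⟩, h5⟩, h6⟩ := h
    have hT' : ∑ n ∈ Finset.Ico m hi, numDiv n ^ 2 ≤ T' := by
      rw [← Finset.sum_Ico_consecutive _ hm h3]
      have hb := sum_numDiv_sq_le_blockSum (s := s) (start := lo) (len := hi - lo) (by omega)
      rw [Nat.add_sub_cancel' h3] at hb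
      omega
    by_cases hhi : hi ≤ N
    · exact ih h6 (hm.trans h3) hT' N hhi hNt
    · have hsum : ∑ n ∈ Finset.Ico m (N + 1), numDiv n ^ 2 ≤ T' :=
        (Finset.sum_le_sum_of_subset (Finset.Ico_subset_Ico_right (by omega))).trans hT'
      refine le_trans ?_ (le_mul_log_cube_of_two_pow_le hN h1 h5)
      exact_mod_cast hsum

theorem checkBlocks_two_pow_thirteen : checkBlocks (2 ^ 13) 70 433 0
   [(470, 21, 2812), (512, 22, 6172), (559, 23, 9916), (609, 24, 14216), (664, 25, 19088),
    (725, 26, 24700), (790, 28, 30588), (862, 29, 37604), (940, 30, 45472), (1024, 31, 53856),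
    (1117, 33, 63436), (1218, 34, 74056), (1328, 36, 86560), (1449, 38, 100324),
    (1580, 39, 115056), (1723, 41, 132352), (1879, 43, 151160), (2048, 45, 172436),
    (2234, 47, 196068), (2436, 49, 222304), (2656, 51, 252512), (2897, 53, 285048),
    (3159, 56, 322296), (3445, 58, 363856), (3757, 61, 409652), (4096, 63, 461228),
    (4467, 66, 518480), (4871, 69, 581752), (5312, 72, 654176), (5793, 76, 733572),
    (6317, 79, 822736), (6889, 82, 922056), (7513, 86, 1031944), (8192, 90, 1156680)] = true := by
  decide +kernel

theorem sum_Ico_numDiv_sq_le {N : ℕ} (hN : 433 ≤ N) :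
    ∑ n ∈ Finset.Ico 433 (N + 1), (numDiv n : ℝ) ^ 2 ≤ N * (log N) ^ 3 / 4 := by
  rcases lt_or_ge N (2 ^ 13) with h | h
  · exact sum_numDiv_sq_le_of_checkBlocks _ checkBlocks_two_pow_thirteen le_rfl (by simp) N hN h
  · refine le_trans (Finset.sum_le_sum_of_subset_of_nonneg (fun n hn => ?_)
      fun _ _ _ => by positivity) (sum_numDiv_sq_le_of_large h)
    rw [Finset.mem_Ico] at hn
    exact Finset.mem_Ioc.2 ⟨by omega, by omega⟩

/-- For `τ > 1` and `X ≥ 433`,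
`Σ_{n ≥ X} d(n)²/n^τ ≤ (τ/(4X^{τ−1}))·((log X)³/(τ−1) + 3(log X)²/(τ−1)² + 6(log X)/(τ−1)³ + 6/(τ−1)⁴)`. -/
theorem divisor_sq_tail_sum (τ X : ℝ) (hτ : 1 < τ) (hX : 433 ≤ X) :
    (∑' n : ℕ, if X ≤ (n : ℝ) then (numDiv n : ℝ)^2 / (n : ℝ)^τ else 0)
      ≤ τ / (4 * X^(τ - 1)) *
        ((Real.log X)^3 / (τ - 1) + 3 * (Real.log X)^2 / (τ - 1)^2
          + 6 * Real.log X / (τ - 1)^3 + 6 / (τ - 1)^4) := by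
  have hX0 : 0 < X := by linarith
  have hM : 433 ≤ ⌈X⌉₊ := by exact_mod_cast hX.trans (Nat.le_ceil X)
  have hK : τ / (4 * X^(τ - 1)) *
        ((Real.log X)^3 / (τ - 1) + 3 * (Real.log X)^2 / (τ - 1)^2
          + 6 * Real.log X / (τ - 1)^3 + 6 / (τ - 1)^4) = logCubeTail τ X := by
    rw [logCubeTail, show 1 - τ = -(τ - 1) by ring, rpow_neg hX0.le, ← div_div, ← div_eq_mul_inv]
  rw [hK]
  have hXM : logCubeTail τ (⌈X⌉₊ : ℝ) ≤ logCubeTail τ X := by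
    have hl := log_nonneg (show (1 : ℝ) ≤ X by linarith)
    simpa using logCubeTail_sub_le (c := 0) hτ (by linarith) (Nat.le_ceil X) (by positivity)
  refine Real.tsum_le_of_sum_range_le (fun n => by split_ifs <;> positivity) fun k => ?_
  refine le_trans ?_ ((sum_mul_rpow_neg_le (a := fun n => (numDiv n : ℝ) ^ 2) hτ (by omega)
    (fun N hN => ?_) k).trans hXM)
  · rw [← Finset.sum_filter]
    refine (Finset.sum_le_sum_of_subset_of_nonneg (t := Finset.Ico ⌈X⌉₊ (⌈X⌉₊ + k))
      (fun n hn => ?_) fun _ _ _ => by positivity).trans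
      (Finset.sum_le_sum fun n _ => by rw [rpow_neg (Nat.cast_nonneg n), div_eq_mul_inv])
    obtain ⟨h1, h2⟩ := Finset.mem_filter.1 hn
    rw [Finset.mem_range] at h1
    exact Finset.mem_Ico.2 ⟨Nat.ceil_le.2 h2, by omega⟩
  · exact (Finset.sum_le_sum_of_subset_of_nonneg (Finset.Ico_subset_Ico_left hM)
      fun _ _ _ => by positivity).trans (sum_Ico_numDiv_sq_le (hM.trans hN))
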